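/- arXiv:2004.02310 — 4 statements merged into one kernel-verified Lean document; each statement's English description precedes it below -/
import Mathlib

section
/- Let n ≥ 1 and let f : PD(n) → S be an affine invariant map satisfying the scalar surjectivity condition. Then for all A, B ∈ GL(n), f(AᵀBᵀBA) = f(BᵀAᵀAB). -/
open scoped Matrix

theorem affine_invariant_smul {n : ℕ} {S : Type*} {f : Matrix (Fin n) (Fin n) ℝ → S}
    (hinv : ∀ (M N A : Matrix (Fin n) (Fin n) ℝ), M.PosDef → N.PosDef → IsUnit A →
      f M = f N → f (Aᵀ * M * A) = f (Aᵀ * N * A))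
    {M N : Matrix (Fin n) (Fin n) ℝ} (hM : M.PosDef) (hN : N.PosDef) (h : f M = f N)
    {s : ℝ} (hs : 0 < s) : f (s • M) = f (s • N) := by
  have hunit : IsUnit (√s • (1 : Matrix (Fin n) (Fin n) ℝ)) :=
    isUnit_one.smul (Units.mk0 (√s) (Real.sqrt_pos.2 hs).ne')
  simpa [smul_smul, Real.mul_self_sqrt hs.le] using hinv M N _ hM hN hunit h

theorem posDef_transpose_mul_self_of_isUnit {n : ℕ} {A : Matrix (Fin n) (Fin n) ℝ}
    (hA : IsUnit A) : (Aᵀ * A).PosDef := by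
  simpa using Matrix.PosDef.conjTranspose_mul_self A (Matrix.mulVec_injective_of_isUnit hA)

theorem affine_invariant_eq_scalar {n : ℕ} {S : Type*} {f : Matrix (Fin n) (Fin n) ℝ → S}
    (hinv : ∀ (M N A : Matrix (Fin n) (Fin n) ℝ), M.PosDef → N.PosDef → IsUnit A →
      f M = f N → f (Aᵀ * M * A) = f (Aᵀ * N * A))
    {A B : Matrix (Fin n) (Fin n) ℝ} (hA : IsUnit A) (hB : IsUnit B) {a b : ℝ}
    (ha : 0 < a) (hb : 0 < b) (hfa : f (a • 1) = f (Aᵀ * A)) (hfb : f (b • 1) = f (Bᵀ * B)) :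
    f (Aᵀ * Bᵀ * B * A) = f ((b * a) • 1) := by
  have h₁ : f (Aᵀ * Bᵀ * B * A) = f (b • (Aᵀ * A)) := by
    simpa [mul_assoc] using hinv _ _ A (posDef_transpose_mul_self_of_isUnit hB)
      (Matrix.PosDef.one.smul hb) hA hfb.symm
  rw [h₁, mul_smul]
  exact affine_invariant_smul hinv (posDef_transpose_mul_self_of_isUnit hA)
    (Matrix.PosDef.one.smul ha) hfa.symm hb

theorem affine_invariant_commute
    {n : ℕ} (hn : 1 ≤ n) {S : Type*} (f : Matrix (Fin n) (Fin n) ℝ → S)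
    (hinv : ∀ (M N A : Matrix (Fin n) (Fin n) ℝ), M.PosDef → N.PosDef → IsUnit A →
      f M = f N → f (Aᵀ * M * A) = f (Aᵀ * N * A))
    (hsurj : ∀ y : S, ∃ s : ℝ, 0 < s ∧ f (s • (1 : Matrix (Fin n) (Fin n) ℝ)) = y) :
    ∀ (A B : Matrix (Fin n) (Fin n) ℝ), IsUnit A → IsUnit B →
      f (Aᵀ * Bᵀ * B * A) = f (Bᵀ * Aᵀ * A * B) := by
  intro A B hA hB
  obtain ⟨a, ha, hfa⟩ := hsurj (f (Aᵀ * A))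
  obtain ⟨b, hb, hfb⟩ := hsurj (f (Bᵀ * B))
  rw [affine_invariant_eq_scalar hinv hA hB ha hb hfa hfb,
    affine_invariant_eq_scalar hinv hB hA hb ha hfb hfa, mul_comm]
end

section
/- Let n ≥ 1 and let f : PD(n) → S be an affine invariant map satisfying the scalar surjectivity condition, and let K := {A ∈ GL(n) : f(AᵀA) = f(I)}. Then K contains the subgroup {A ∈ GL(n) : det(A)² = 1}: every A ∈ GL(n) with det(A) = 1 or det(A) = −1 satisfies f(AᵀA) = f(I). -/
open scoped Matrix

section AffineInvariant

variable {n : ℕ} {S : Type*} {f : Matrix (Fin n) (Fin n) ℝ → S}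

theorem affineInvariant_orthogonal_conj
    (hinv : ∀ (M N A : Matrix (Fin n) (Fin n) ℝ), M.PosDef → N.PosDef → IsUnit A →
      f M = f N → f (Aᵀ * M * A) = f (Aᵀ * N * A))
    (hsurj : ∀ y : S, ∃ s : ℝ, 0 < s ∧ f (s • (1 : Matrix (Fin n) (Fin n) ℝ)) = y)
    {U M : Matrix (Fin n) (Fin n) ℝ} (hU : Uᵀ * U = 1) (hM : M.PosDef) :
    f (Uᵀ * M * U) = f M := by
  obtain ⟨s, hs, hsM⟩ := hsurj (f M)
  have h := hinv M (s • 1) U hM (Matrix.PosDef.one.smul hs)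
    (IsUnit.of_mul_eq_one_right _ hU) hsM.symm
  rw [h, ← hsM]
  simp [hU]

theorem affineInvariant_diagonal_mul
    (hinv : ∀ (M N A : Matrix (Fin n) (Fin n) ℝ), M.PosDef → N.PosDef → IsUnit A →
      f M = f N → f (Aᵀ * M * A) = f (Aᵀ * N * A))
    {d e h : Fin n → ℝ} (hd : ∀ i, 0 < d i) (he : ∀ i, 0 < e i) (hh : ∀ i, 0 < h i)
    (hde : f (Matrix.diagonal d) = f (Matrix.diagonal e)) :
    f (Matrix.diagonal (d * h)) = f (Matrix.diagonal (e * h)) := by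
  have key : ∀ c : Fin n → ℝ, (Matrix.diagonal fun i => √(h i))ᵀ * Matrix.diagonal c *
      (Matrix.diagonal fun i => √(h i)) = Matrix.diagonal (c * h) := by
    intro c
    rw [Matrix.diagonal_transpose, Matrix.diagonal_mul_diagonal, Matrix.diagonal_mul_diagonal]
    congr 1
    ext i
    rw [mul_right_comm, Real.mul_self_sqrt (hh i).le, mul_comm, Pi.mul_apply]
  have hu : IsUnit (Matrix.diagonal fun i => √(h i)) := by
    rw [Matrix.isUnit_diagonal, Pi.isUnit_iff]
    exact fun i => (Real.sqrt_pos.2 (hh i)).ne'.isUnit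
  rw [← key d, ← key e]
  exact hinv _ _ _ (Matrix.PosDef.diagonal hd) (Matrix.PosDef.diagonal he) hu hde

theorem mulSingle_apply_pos (i : Fin n) {t : ℝ} (ht : 0 < t) (k : Fin n) :
    0 < (Pi.mulSingle i t : Fin n → ℝ) k := by
  rcases eq_or_ne k i with rfl | hk
  · simpa using ht
  · simp [hk]

theorem affineInvariant_diagonal_mulSingle
    (hinv : ∀ (M N A : Matrix (Fin n) (Fin n) ℝ), M.PosDef → N.PosDef → IsUnit A →
      f M = f N → f (Aᵀ * M * A) = f (Aᵀ * N * A))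
    (hsurj : ∀ y : S, ∃ s : ℝ, 0 < s ∧ f (s • (1 : Matrix (Fin n) (Fin n) ℝ)) = y)
    (i j : Fin n) {t : ℝ} (ht : 0 < t) :
    f (Matrix.diagonal (Pi.mulSingle i t)) = f (Matrix.diagonal (Pi.mulSingle j t)) := by
  let P : Matrix (Fin n) (Fin n) ℝ := (Equiv.swap i j).permMatrix ℝ
  have hPt : Pᵀ = P := by simp [P, Matrix.transpose_permMatrix]
  have hP : Pᵀ * P = 1 := by
    rw [hPt]
    simp only [P, ← Matrix.permMatrix_mul, Equiv.swap_mul_self, Matrix.permMatrix_one]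
  rw [← affineInvariant_orthogonal_conj hinv hsurj hP
    (Matrix.PosDef.diagonal (mulSingle_apply_pos i ht)), hPt]
  congr 1
  ext a b
  simp only [P, Equiv.Perm.permMatrix, PEquiv.toMatrix_toPEquiv_mul,
    PEquiv.mul_toMatrix_toPEquiv, Matrix.submatrix_apply, Matrix.diagonal_apply, id,
    Equiv.symm_swap, EmbeddingLike.apply_eq_iff_eq]
  congr 1
  simp only [Pi.mulSingle_apply, Equiv.swap_apply_eq_iff, Equiv.swap_apply_left]

theorem affineInvariant_diagonal_of_prod_eq_one
    (hinv : ∀ (M N A : Matrix (Fin n) (Fin n) ℝ), M.PosDef → N.PosDef → IsUnit A →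
      f M = f N → f (Aᵀ * M * A) = f (Aᵀ * N * A))
    (hsurj : ∀ y : S, ∃ s : ℝ, 0 < s ∧ f (s • (1 : Matrix (Fin n) (Fin n) ℝ)) = y)
    (i₀ : Fin n) {d : Fin n → ℝ} (hd : ∀ i, 0 < d i) (hprod : ∏ i, d i = 1) :
    f (Matrix.diagonal d) = f 1 := by
  have main : ∀ s : Finset (Fin n),
      f (Matrix.diagonal (∏ i ∈ s, Pi.mulSingle i (d i))) =
        f (Matrix.diagonal (Pi.mulSingle i₀ (∏ i ∈ s, d i))) := by
    intro s
    induction s using Finset.induction_on with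
    | empty => simp
    | insert a s ha ih =>
      have hp : 0 < ∏ i ∈ s, d i := Finset.prod_pos fun i _ => hd i
      have hq : ∀ k, 0 < (∏ i ∈ s, (Pi.mulSingle i (d i) : Fin n → ℝ)) k := fun k => by
        rw [Finset.prod_apply]
        exact Finset.prod_pos fun i _ => mulSingle_apply_pos i (hd i) k
      rw [Finset.prod_insert ha, Finset.prod_insert ha, Pi.mulSingle_mul,
        affineInvariant_diagonal_mul hinv (mulSingle_apply_pos a (hd a))
          (mulSingle_apply_pos i₀ (hd a)) hq
          (affineInvariant_diagonal_mulSingle hinv hsurj a i₀ (hd a)),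
        mul_comm, affineInvariant_diagonal_mul hinv hq (mulSingle_apply_pos i₀ hp)
          (mulSingle_apply_pos i₀ (hd a)) ih, mul_comm]
  have h := main Finset.univ
  rwa [Finset.univ_prod_mulSingle, hprod, Pi.mulSingle_one, Matrix.diagonal_one'] at h

end AffineInvariant

theorem affine_invariant_K_contains_det_sq_one
    {n : ℕ} (hn : 1 ≤ n) {S : Type*} (f : Matrix (Fin n) (Fin n) ℝ → S)
    (hinv : ∀ (M N A : Matrix (Fin n) (Fin n) ℝ), M.PosDef → N.PosDef → IsUnit A →
      f M = f N → f (Aᵀ * M * A) = f (Aᵀ * N * A))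
    (hsurj : ∀ y : S, ∃ s : ℝ, 0 < s ∧ f (s • (1 : Matrix (Fin n) (Fin n) ℝ)) = y) :
    ∀ (A : Matrix (Fin n) (Fin n) ℝ), A.det = 1 ∨ A.det = -1 →
      f (Aᵀ * A) = f (1 : Matrix (Fin n) (Fin n) ℝ) := by
  intro A hA
  have hdet : (Aᵀ * A).det = 1 := by
    rw [Matrix.det_mul, Matrix.det_transpose]
    rcases hA with h | h <;> simp [h]
  have hM : (Aᵀ * A).PosDef := by
    have hu : IsUnit A := by
      rw [Matrix.isUnit_iff_isUnit_det]
      rcases hA with h | h <;> simp [h]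
    simpa using Matrix.PosDef.conjTranspose_mul_self A (Matrix.mulVec_injective_of_isUnit hu)
  let U : Matrix (Fin n) (Fin n) ℝ := hM.isHermitian.eigenvectorUnitary
  have hU : U * Uᵀ = 1 := by
    simpa [Matrix.star_eq_conjTranspose] using
      Unitary.coe_mul_star_self hM.isHermitian.eigenvectorUnitary
  have hspec : Aᵀ * A = U * Matrix.diagonal hM.isHermitian.eigenvalues * Uᵀ := by
    have h := hM.isHermitian.spectral_theorem
    rw [Unitary.conjStarAlgAut_apply] at h
    simpa [Matrix.star_eq_conjTranspose, Function.comp_def] using h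
  have hpos := hM.eigenvalues_pos
  have hprod : ∏ i, hM.isHermitian.eigenvalues i = 1 := by
    rw [← hdet, hM.isHermitian.det_eq_prod_eigenvalues]
    simp
  have hconj := affineInvariant_orthogonal_conj hinv hsurj (U := Uᵀ)
    (by rwa [Matrix.transpose_transpose]) (Matrix.PosDef.diagonal hpos)
  rw [Matrix.transpose_transpose, ← hspec] at hconj
  rw [hconj]
  exact affineInvariant_diagonal_of_prod_eq_one hinv hsurj ⟨0, hn⟩ hpos hprod
end

section
/- Let n ≥ 1 and let f : PD(n) → S be an affine invariant map satisfying the scalar surjectivity condition, and let K := {A ∈ GL(n) : f(AᵀA) = f(I)}. Then the coset of A in GL(n)/K is determined by det(A)²: for all A, B ∈ GL(n) with det(A)² = det(B)², one has AB⁻¹ ∈ K, i.e., f((AB⁻¹)ᵀ(AB⁻¹)) = f(I). -/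
open scoped Matrix

section AffineInvariant

open Matrix

variable {n : ℕ} {S : Type*} {f : Matrix (Fin n) (Fin n) ℝ → S}

/-- An affine invariant, scalar surjective map is invariant under orthogonal congruence. -/
theorem affine_invariant_orthogonal_congr
    (hinv : ∀ (M N A : Matrix (Fin n) (Fin n) ℝ), M.PosDef → N.PosDef → IsUnit A →
      f M = f N → f (Aᵀ * M * A) = f (Aᵀ * N * A))
    (hsurj : ∀ y : S, ∃ s : ℝ, 0 < s ∧ f (s • (1 : Matrix (Fin n) (Fin n) ℝ)) = y)
    {M U : Matrix (Fin n) (Fin n) ℝ} (hM : M.PosDef) (hU : Uᵀ * U = 1) :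
    f (Uᵀ * M * U) = f M := by
  obtain ⟨s, hs, hfs⟩ := hsurj (f M)
  have h := hinv _ _ U (PosDef.one.smul hs) hM (.of_mul_eq_one_right _ hU) hfs
  rw [← h, ← hfs]
  simp [hU]

/-- Equality of the values at diagonal matrices is preserved by entrywise multiplication. -/
theorem affine_invariant_diagonal_mul
    (hinv : ∀ (M N A : Matrix (Fin n) (Fin n) ℝ), M.PosDef → N.PosDef → IsUnit A →
      f M = f N → f (Aᵀ * M * A) = f (Aᵀ * N * A))
    {d d' e : Fin n → ℝ} (hd : ∀ i, 0 < d i) (hd' : ∀ i, 0 < d' i) (he : ∀ i, 0 < e i)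
    (h : f (diagonal d) = f (diagonal d')) :
    f (diagonal (d * e)) = f (diagonal (d' * e)) := by
  have key (c : Fin n → ℝ) : (diagonal fun i => √(e i))ᵀ * diagonal c *
      (diagonal fun i => √(e i)) = diagonal (c * e) := by
    rw [diagonal_transpose, diagonal_mul_diagonal, diagonal_mul_diagonal]
    congr 1
    ext i
    rw [mul_comm, ← mul_assoc, Real.mul_self_sqrt (he i).le, mul_comm, Pi.mul_apply]
  rw [← key, ← key]
  refine hinv _ _ _ (.diagonal hd) (.diagonal hd') ?_ h
  rw [isUnit_diagonal, Pi.isUnit_iff]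
  exact fun i => (Real.sqrt_pos.2 (he i)).ne'.isUnit

/-- The value at a positive diagonal matrix is unchanged by permuting the diagonal. -/
theorem affine_invariant_diagonal_perm
    (hinv : ∀ (M N A : Matrix (Fin n) (Fin n) ℝ), M.PosDef → N.PosDef → IsUnit A →
      f M = f N → f (Aᵀ * M * A) = f (Aᵀ * N * A))
    (hsurj : ∀ y : S, ∃ s : ℝ, 0 < s ∧ f (s • (1 : Matrix (Fin n) (Fin n) ℝ)) = y)
    {d : Fin n → ℝ} (hd : ∀ i, 0 < d i) (σ : Equiv.Perm (Fin n)) :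
    f (diagonal (d ∘ σ)) = f (diagonal d) := by
  have hU : (σ⁻¹.permMatrix ℝ)ᵀ * σ⁻¹.permMatrix ℝ = 1 := by
    rw [transpose_permMatrix, ← permMatrix_mul]
    simp
  rw [← affine_invariant_orthogonal_congr hinv hsurj (.diagonal hd) hU]
  congr 1
  rw [transpose_permMatrix, inv_inv]
  rw [Equiv.Perm.permMatrix, Equiv.Perm.permMatrix, PEquiv.toMatrix_toPEquiv_mul,
    PEquiv.mul_toMatrix_toPEquiv, submatrix_submatrix]
  exact (submatrix_diagonal_equiv d σ).symm

/-- The value at a positive diagonal matrix depends only on the product of its entries. -/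
theorem affine_invariant_diagonal_eq_prod
    (hinv : ∀ (M N A : Matrix (Fin n) (Fin n) ℝ), M.PosDef → N.PosDef → IsUnit A →
      f M = f N → f (Aᵀ * M * A) = f (Aᵀ * N * A))
    (hsurj : ∀ y : S, ∃ s : ℝ, 0 < s ∧ f (s • (1 : Matrix (Fin n) (Fin n) ℝ)) = y)
    {d : Fin n → ℝ} (hd : ∀ i, 0 < d i) (j : Fin n) :
    f (diagonal d) = f (diagonal (Pi.mulSingle j (∏ i, d i))) := by
  have single_pos (i : Fin n) {c : ℝ} (hc : 0 < c) (k : Fin n) :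
      0 < (Pi.mulSingle i c : Fin n → ℝ) k := by
    rw [Pi.mulSingle_apply]
    split_ifs <;> positivity
  have swap {p : Fin n → ℝ} (hp : ∀ i, 0 < p i) (i : Fin n) {c : ℝ} (hc : 0 < c) :
      f (diagonal (p * Pi.mulSingle i c)) = f (diagonal (p * Pi.mulSingle j c)) := by
    obtain ⟨s, hs, hfs⟩ := hsurj (f (diagonal p))
    rw [smul_one_eq_diagonal] at hfs
    have hs' : ∀ _ : Fin n, 0 < s := fun _ => hs
    let q : Fin n → ℝ := (fun _ => s) * Pi.mulSingle j c
    have hq : ∀ k, 0 < q k := fun k => mul_pos hs (single_pos j hc k)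
    rw [← affine_invariant_diagonal_mul hinv hs' hp (single_pos i hc) hfs,
      ← affine_invariant_diagonal_mul hinv hs' hp (single_pos j hc) hfs]
    refine Eq.trans ?_ (affine_invariant_diagonal_perm hinv hsurj hq (Equiv.swap i j))
    congr 2
    ext k
    simp only [q, Pi.mul_apply, Function.comp_apply, Pi.mulSingle_apply, Equiv.swap_apply_eq_iff,
      Equiv.swap_apply_right]
  have partial_prod (t : Finset (Fin n)) :
      f (diagonal (∏ i ∈ t, Pi.mulSingle i (d i))) =
        f (diagonal (Pi.mulSingle j (∏ i ∈ t, d i))) := by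
    induction t using Finset.induction_on with
    | empty => simp
    | insert a t ha ih =>
      have hp (k : Fin n) : 0 < (∏ i ∈ t, (Pi.mulSingle i (d i) : Fin n → ℝ)) k := by
        rw [Finset.prod_apply]
        exact Finset.prod_pos fun i _ => single_pos i (hd i) k
      rw [Finset.prod_insert ha, Finset.prod_insert ha, mul_comm, swap hp a (hd a),
        mul_comm (d a), Pi.mulSingle_mul]
      exact affine_invariant_diagonal_mul hinv hp
        (single_pos j (Finset.prod_pos fun i _ => hd i)) (single_pos j (hd a)) ih
  rw [← partial_prod, Finset.univ_prod_mulSingle]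

/-- The value at a positive definite matrix of determinant one is the value at the identity. -/
theorem affine_invariant_eq_one_of_det_eq_one (hn : 1 ≤ n)
    (hinv : ∀ (M N A : Matrix (Fin n) (Fin n) ℝ), M.PosDef → N.PosDef → IsUnit A →
      f M = f N → f (Aᵀ * M * A) = f (Aᵀ * N * A))
    (hsurj : ∀ y : S, ∃ s : ℝ, 0 < s ∧ f (s • (1 : Matrix (Fin n) (Fin n) ℝ)) = y)
    {M : Matrix (Fin n) (Fin n) ℝ} (hM : M.PosDef) (hdet : M.det = 1) : f M = f 1 := by
  have hprod : ∏ i, hM.1.eigenvalues i = 1 := by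
    simpa [hdet] using hM.1.det_eq_prod_eigenvalues.symm
  set V : Matrix (Fin n) (Fin n) ℝ := hM.1.eigenvectorUnitary.1 with hV
  have hVV : Vᵀᵀ * Vᵀ = 1 := by
    simpa [star_eq_conjTranspose] using Unitary.coe_mul_star_self hM.1.eigenvectorUnitary
  have hspec : M = Vᵀᵀ * diagonal hM.1.eigenvalues * Vᵀ := by
    conv_lhs => rw [hM.1.spectral_theorem, Unitary.conjStarAlgAut_apply]
    simp [hV, star_eq_conjTranspose]
  have hpos := hM.eigenvalues_pos
  calc f M = f (Vᵀᵀ * diagonal hM.1.eigenvalues * Vᵀ) := congrArg f hspec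
    _ = f (diagonal hM.1.eigenvalues) :=
      affine_invariant_orthogonal_congr hinv hsurj (.diagonal hpos) hVV
    _ = f 1 := by
      rw [affine_invariant_diagonal_eq_prod hinv hsurj hpos ⟨0, hn⟩, hprod]
      simp

end AffineInvariant

theorem affine_invariant_coset_determined_by_det_sq
    {n : ℕ} (hn : 1 ≤ n) {S : Type*} (f : Matrix (Fin n) (Fin n) ℝ → S)
    (hinv : ∀ (M N A : Matrix (Fin n) (Fin n) ℝ), M.PosDef → N.PosDef → IsUnit A →
      f M = f N → f (Aᵀ * M * A) = f (Aᵀ * N * A))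
    (hsurj : ∀ y : S, ∃ s : ℝ, 0 < s ∧ f (s • (1 : Matrix (Fin n) (Fin n) ℝ)) = y) :
    ∀ (A B : Matrix (Fin n) (Fin n) ℝ), IsUnit A → IsUnit B →
      A.det ^ 2 = B.det ^ 2 →
      f ((A * B⁻¹)ᵀ * (A * B⁻¹)) = f (1 : Matrix (Fin n) (Fin n) ℝ) := by
  intro A B hA hB hAB
  have hC : IsUnit (A * B⁻¹) := hA.mul ((Matrix.isUnit_nonsing_inv_iff).2 hB)
  have hB0 : B.det ≠ 0 := ((Matrix.isUnit_iff_isUnit_det B).1 hB).ne_zero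
  refine affine_invariant_eq_one_of_det_eq_one hn hinv hsurj ?_ ?_
  · rw [← Matrix.conjTranspose_eq_transpose_of_trivial]
    exact .conjTranspose_mul_self _ (Matrix.mulVec_injective_of_isUnit hC)
  · rw [Matrix.det_mul, Matrix.det_transpose, Matrix.det_mul, Matrix.det_nonsing_inv,
      Ring.inverse_eq_inv']
    field_simp
    exact hAB
end

section
/- Let n ≥ 1 and let f : PD(n) → S be an affine invariant map satisfying the scalar surjectivity condition, and suppose additionally that f is injective on positive scalar matrices, i.e., f(sI) = f(tI) implies s = t for all s, t ∈ (0,∞). Then for all M, N ∈ PD(n), f(M) = f(N) if and only if det(M) = det(N). -/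
open scoped Matrix

section CongruenceCharacter

variable {ι : Type*} [Fintype ι] [DecidableEq ι] {g : Matrix ι ι ℝ → ℝ}

/-- A function compatible with congruences is invariant under orthogonal congruences. -/
lemma apply_orthogonal_congr
    (hone : g 1 = 1)
    (hmul : ∀ M A : Matrix ι ι ℝ, M.PosDef → IsUnit A → g (Aᵀ * M * A) = g M * g (Aᵀ * A))
    {M A : Matrix ι ι ℝ} (hM : M.PosDef) (hA : Aᵀ * A = 1) : g (Aᵀ * M * A) = g M := by
  rw [hmul M A hM (IsUnit.of_mul_eq_one_right _ hA), hA, hone, mul_one]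

lemma apply_diagonal_mul
    (hmul : ∀ M A : Matrix ι ι ℝ, M.PosDef → IsUnit A → g (Aᵀ * M * A) = g M * g (Aᵀ * A))
    {a b : ι → ℝ} (ha : ∀ i, 0 < a i) (hb : ∀ i, 0 < b i) :
    g (Matrix.diagonal (a * b)) = g (Matrix.diagonal a) * g (Matrix.diagonal b) := by
  have hu : IsUnit (Matrix.diagonal fun i => √(b i)) := by
    rw [Matrix.isUnit_diagonal, Pi.isUnit_iff]
    exact fun i => (Real.sqrt_pos.2 (hb i)).ne'.isUnit
  have h := hmul (Matrix.diagonal a) _ (Matrix.PosDef.diagonal ha) hu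
  simp only [Matrix.diagonal_transpose, Matrix.diagonal_mul_diagonal] at h
  have hsq : (fun i => √(b i) * √(b i)) = b := funext fun i => Real.mul_self_sqrt (hb i).le
  have hconj : (fun i => √(b i) * a i * √(b i)) = a * b := by
    funext i
    rw [mul_right_comm, Real.mul_self_sqrt (hb i).le, mul_comm, Pi.mul_apply]
  rwa [hsq, hconj] at h

lemma apply_diagonal_prod
    (hone : g 1 = 1)
    (hmul : ∀ M A : Matrix ι ι ℝ, M.PosDef → IsUnit A → g (Aᵀ * M * A) = g M * g (Aᵀ * A))
    {κ : Type*} (s : Finset κ) {d : κ → ι → ℝ} (hd : ∀ k i, 0 < d k i) :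
    g (Matrix.diagonal (∏ k ∈ s, d k)) = ∏ k ∈ s, g (Matrix.diagonal (d k)) := by
  classical
  induction s using Finset.induction_on with
  | empty => simpa using hone
  | insert k s hk ih =>
    rw [Finset.prod_insert hk, Finset.prod_insert hk, apply_diagonal_mul hmul (hd k), ih]
    intro i
    rw [Finset.prod_apply]
    exact Finset.prod_pos fun j _ => hd j i

lemma apply_diagonal_comp_perm
    (hone : g 1 = 1)
    (hmul : ∀ M A : Matrix ι ι ℝ, M.PosDef → IsUnit A → g (Aᵀ * M * A) = g M * g (Aᵀ * A))
    {d : ι → ℝ} (hd : ∀ i, 0 < d i) (σ : Equiv.Perm ι) :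
    g (Matrix.diagonal (d ∘ σ)) = g (Matrix.diagonal d) := by
  have key (M : Matrix ι ι ℝ) : ((1 : Matrix ι ι ℝ).submatrix id σ)ᵀ * M *
      (1 : Matrix ι ι ℝ).submatrix id σ = M.submatrix σ σ := by
    ext i j
    simp [Matrix.mul_apply, Matrix.one_apply]
  have h := apply_orthogonal_congr hone hmul (A := (1 : Matrix ι ι ℝ).submatrix id σ)
    (Matrix.PosDef.diagonal hd) (by simpa using key 1)
  rwa [key, Matrix.submatrix_diagonal_equiv] at h

end CongruenceCharacter

/-- A function on positive definite matrices that is compatible with congruences and is the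
identity on positive scalars is the `n`-th root of the determinant. -/
lemma pow_eq_det_of_congr_mul {n : ℕ} [NeZero n] {g : Matrix (Fin n) (Fin n) ℝ → ℝ}
    (hscalar : ∀ s : ℝ, 0 < s → g (s • 1) = s)
    (hmul : ∀ M A : Matrix (Fin n) (Fin n) ℝ, M.PosDef → IsUnit A →
      g (Aᵀ * M * A) = g M * g (Aᵀ * A))
    {M : Matrix (Fin n) (Fin n) ℝ} (hM : M.PosDef) : g M ^ n = M.det := by
  have hone : g 1 = 1 := by simpa using hscalar 1 one_pos
  set d := hM.isHermitian.eigenvalues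
  have hd : ∀ i, 0 < d i := hM.eigenvalues_pos
  have hdet : M.det = ∏ i, d i := by simpa using hM.isHermitian.det_eq_prod_eigenvalues
  have hdiag : g M = g (Matrix.diagonal d) := by
    have hU := Unitary.mul_star_self_of_mem hM.isHermitian.eigenvectorUnitary.2
    set U : Matrix (Fin n) (Fin n) ℝ := hM.isHermitian.eigenvectorUnitary.1
    have hspec : M = Uᵀᵀ * Matrix.diagonal d * Uᵀ := by
      conv_lhs => rw [hM.isHermitian.spectral_theorem]
      rfl
    rw [hspec]
    exact apply_orthogonal_congr hone hmul (Matrix.PosDef.diagonal hd) hU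
  have hprod := apply_diagonal_prod hone hmul Finset.univ
    (d := fun k : Fin n => d ∘ Equiv.addRight k) (fun k i => hd _)
  have hshift : (∏ k : Fin n, d ∘ Equiv.addRight k) = fun _ => ∏ i, d i := by
    funext i
    rw [Finset.prod_apply]
    exact Equiv.prod_comp (Equiv.addLeft i) d
  simp only [apply_diagonal_comp_perm hone hmul hd, Finset.prod_const, Finset.card_univ,
    Fintype.card_fin] at hprod
  rw [hdiag, hdet, ← hprod, hshift, ← Matrix.smul_one_eq_diagonal,
    hscalar _ (Finset.prod_pos fun i _ => hd i)]

theorem affine_invariant_injective_scalars_iff_det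
    {n : ℕ} (hn : 1 ≤ n) {S : Type*} (f : Matrix (Fin n) (Fin n) ℝ → S)
    (hinv : ∀ (M N A : Matrix (Fin n) (Fin n) ℝ), M.PosDef → N.PosDef → IsUnit A →
      f M = f N → f (Aᵀ * M * A) = f (Aᵀ * N * A))
    (hsurj : ∀ y : S, ∃ s : ℝ, 0 < s ∧ f (s • (1 : Matrix (Fin n) (Fin n) ℝ)) = y)
    (hinj : ∀ s t : ℝ, 0 < s → 0 < t →
      f (s • (1 : Matrix (Fin n) (Fin n) ℝ)) = f (t • (1 : Matrix (Fin n) (Fin n) ℝ)) →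
      s = t) :
    ∀ (M N : Matrix (Fin n) (Fin n) ℝ), M.PosDef → N.PosDef →
      (f M = f N ↔ M.det = N.det) := by
  have : NeZero n := ⟨by omega⟩
  choose r hr hfr using hsurj
  have hscalarPosDef {s : ℝ} (hs : 0 < s) : (s • (1 : Matrix (Fin n) (Fin n) ℝ)).PosDef :=
    Matrix.PosDef.one.smul hs
  have hscalar (s : ℝ) (hs : 0 < s) : r (f (s • 1)) = s := hinj _ _ (hr _) hs (hfr _)
  have hsmul {M : Matrix (Fin n) (Fin n) ℝ} (hM : M.PosDef) {s : ℝ} (hs : 0 < s) :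
      r (f (s • M)) = s * r (f M) := by
    have hcongr (N : Matrix (Fin n) (Fin n) ℝ) :
        (√s • (1 : Matrix (Fin n) (Fin n) ℝ))ᵀ * N * (√s • 1) = s • N := by
      simp [smul_smul, Real.mul_self_sqrt hs.le]
    have h := hinv _ M _ (hscalarPosDef (hr (f M))) hM
      (hscalarPosDef (Real.sqrt_pos.2 hs)).isUnit (hfr (f M))
    rw [hcongr, hcongr, smul_smul] at h
    rw [← h, hscalar _ (mul_pos hs (hr _))]
  have hmul (M A : Matrix (Fin n) (Fin n) ℝ) (hM : M.PosDef) (hA : IsUnit A) :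
      r (f (Aᵀ * M * A)) = r (f M) * r (f (Aᵀ * A)) := by
    have hAA : (Aᵀ * A).PosDef := by
      simpa using Matrix.PosDef.conjTranspose_mul_self A (Matrix.mulVec_injective_of_isUnit hA)
    rw [← hsmul hAA (hr _), hinv M _ A hM (hscalarPosDef (hr (f M))) hA (hfr _).symm]
    simp
  intro M N hM hN
  have hMdet := pow_eq_det_of_congr_mul (g := fun M => r (f M)) hscalar hmul hM
  have hNdet := pow_eq_det_of_congr_mul (g := fun M => r (f M)) hscalar hmul hN
  rw [← hMdet, ← hNdet, pow_left_inj₀ (hr _).le (hr _).le (by omega)]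
  exact ⟨congrArg r, fun h => by rw [← hfr (f M), ← hfr (f N), h]⟩
end
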